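/- Fix ρ > 0 and assume d(n) → ∞ and (n − d)/d → ρ. Let f_ρ(r) = ρ·ln Φ(r) − r²/2 for r ∈ ℝ and let r_ρ ∈ (0, ∞) be its unique maximizer. Then √d·H_typ converges in probability to r_ρ; concretely, for every fixed ε ∈ (0, r_ρ), I(n,d,−1, (r_ρ−ε)/√d)/I(n,d,−1,1) → 0 and I(n,d,−1, (r_ρ+ε)/√d)/I(n,d,−1,1) → 1 as n → ∞. -/

import Mathlib

open Filter

noncomputable def c1 (d : ℕ) : ℝ :=
  Real.Gamma ((d : ℝ) / 2) / (Real.sqrt Real.pi * Real.Gamma (((d : ℝ) - 1) / 2))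

noncomputable def c2 (d : ℕ) : ℝ :=
  Real.Gamma (((d : ℝ) ^ 2 - 2 * (d : ℝ) + 2) / 2) /
    (Real.sqrt Real.pi * Real.Gamma (((d : ℝ) ^ 2 - 2 * (d : ℝ) + 1) / 2))

/-- `II n d a b` is the integral `I(n,d,a,b)` from the paper. -/
noncomputable def II (n d : ℕ) (a b : ℝ) : ℝ :=
  ∫ h in a..b, (1 - h ^ 2) ^ (((d : ℝ) ^ 2 - 2 * (d : ℝ) - 1) / 2) *
    (c1 d * ∫ s in (-1 : ℝ)..h, (1 - s ^ 2) ^ (((d : ℝ) - 3) / 2)) ^ (n - d)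

/-- `FF n d a b` is the expected number of facets with height in `[a,b]`. -/
noncomputable def FF (n d : ℕ) (a b : ℝ) : ℝ :=
  (n.choose d : ℝ) * 2 * c2 d * II n d a b

/-- The standard normal CDF. -/
noncomputable def stdPhi (r : ℝ) : ℝ :=
  (Real.sqrt (2 * Real.pi))⁻¹ * ∫ s in Set.Iic r, Real.exp (-s ^ 2 / 2)

/-- `f_ρ(r) = ρ ln Φ(r) - r²/2`. -/
noncomputable def frho (ρ r : ℝ) : ℝ := ρ * Real.log (stdPhi r) - r ^ 2 / 2

/-- The unnormalised spherical cap mass in the scale `√d`, divided by `√(2π)`. -/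
noncomputable def capMass (d : ℕ) (r : ℝ) : ℝ :=
  (Real.sqrt (2 * Real.pi))⁻¹ *
    ∫ t in (-Real.sqrt d)..r, (1 - t ^ 2 / d) ^ (((d : ℝ) - 3) / 2)

theorem integrable_exp_neg_sq_div_two :
    MeasureTheory.Integrable (fun s : ℝ => Real.exp (-s ^ 2 / 2)) := by
  have := integrable_exp_neg_mul_sq (b := 1 / 2) (by norm_num)
  refine this.congr (Eventually.of_forall fun x => ?_)
  simp only
  congr 1
  ring

theorem stdPhi_mono : Monotone stdPhi := by
  intro a b hab
  unfold stdPhi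
  refine mul_le_mul_of_nonneg_left ?_ (by positivity)
  exact MeasureTheory.setIntegral_mono_set integrable_exp_neg_sq_div_two.integrableOn
    (Eventually.of_forall fun x => (Real.exp_pos _).le) (Set.Iic_subset_Iic.2 hab).eventuallyLE

theorem stdPhi_pos (r : ℝ) : 0 < stdPhi r := by
  unfold stdPhi
  refine mul_pos (by positivity) ?_
  rw [MeasureTheory.setIntegral_pos_iff_support_of_nonneg_ae
    (Eventually.of_forall fun x => (Real.exp_pos _).le)
    integrable_exp_neg_sq_div_two.integrableOn]
  have : Function.support (fun s : ℝ => Real.exp (-s ^ 2 / 2)) = Set.univ := by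
    ext x
    simp [Real.exp_ne_zero]
  simp [this]

theorem stdPhi_le_one (r : ℝ) : stdPhi r ≤ 1 := by
  unfold stdPhi
  have h1 : ∫ s : ℝ, Real.exp (-s ^ 2 / 2) = Real.sqrt (2 * Real.pi) := by
    have := integral_gaussian (1 / 2)
    rw [show Real.pi / (1 / 2) = 2 * Real.pi by ring] at this
    rw [← this]
    congr 1
    ext x
    congr 1
    ring
  have h2 := MeasureTheory.setIntegral_le_integral (s := Set.Iic r) integrable_exp_neg_sq_div_two
    (Eventually.of_forall fun x => (Real.exp_pos _).le)
  rw [h1] at h2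
  rw [inv_mul_le_iff₀ (by positivity)]
  linarith

theorem continuous_stdPhi : Continuous stdPhi := by
  unfold stdPhi
  refine continuous_const.mul ?_
  have h : (fun r : ℝ => ∫ s in Set.Iic r, Real.exp (-s ^ 2 / 2)) =
      fun r => (∫ s in Set.Iic (0 : ℝ), Real.exp (-s ^ 2 / 2)) +
        ∫ s in (0 : ℝ)..r, Real.exp (-s ^ 2 / 2) := by
    ext r
    rw [← intervalIntegral.integral_Iic_sub_Iic integrable_exp_neg_sq_div_two.integrableOn
      integrable_exp_neg_sq_div_two.integrableOn]
    ring
  rw [h]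
  exact continuous_const.add (intervalIntegral.continuous_primitive
    (fun a b => integrable_exp_neg_sq_div_two.intervalIntegrable) 0)

theorem continuous_frho (ρ : ℝ) : Continuous (frho ρ) := by
  unfold frho
  exact (continuous_const.mul (continuous_stdPhi.log fun r => (stdPhi_pos r).ne')).sub
    (by fun_prop)

/-- Away from its unique maximizer, `frho ρ` stays below its maximum by a definite gap. -/
theorem exists_gap_frho {ρ rρ ε : ℝ} (hρ : 0 < ρ) (hε : 0 < ε)
    (hmax : ∀ r : ℝ, r ≠ rρ → frho ρ r < frho ρ rρ) :
    ∃ δ : ℝ, 0 < δ ∧ ∀ r : ℝ, 0 ≤ r → ε ≤ |r - rρ| → frho ρ r ≤ frho ρ rρ - δ := by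
  have hle : ∀ r, frho ρ r ≤ -r ^ 2 / 2 := by
    intro r
    have := Real.log_nonpos (stdPhi_pos r).le (stdPhi_le_one r)
    unfold frho
    nlinarith
  set R : ℝ := 2 * |frho ρ rρ| + 2 with hR
  have hfar : ∀ r, R ≤ r → frho ρ r ≤ frho ρ rρ - 1 := by
    intro r hr
    have h1 := hle r
    have h2 := neg_abs_le (frho ρ rρ)
    have h3 := abs_nonneg (frho ρ rρ)
    nlinarith
  have hcomp : IsCompact (Set.Icc 0 R ∩ {r : ℝ | ε ≤ |r - rρ|}) :=
    isCompact_Icc.inter_right (isClosed_le continuous_const (by fun_prop))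
  rcases (Set.Icc 0 R ∩ {r : ℝ | ε ≤ |r - rρ|}).eq_empty_or_nonempty with he | hne
  · refine ⟨1, one_pos, fun r hr0 hr => ?_⟩
    refine hfar r (le_of_not_ge fun hrR => ?_)
    have : r ∈ (∅ : Set ℝ) := he ▸ ⟨⟨hr0, hrR⟩, hr⟩
    exact this
  · obtain ⟨x, ⟨-, hx⟩, hxm⟩ := hcomp.exists_isMaxOn hne (continuous_frho ρ).continuousOn
    have hxne : x ≠ rρ := by
      rintro rfl
      simp at hx
      linarith
    refine ⟨min 1 (frho ρ rρ - frho ρ x), lt_min one_pos (by linarith [hmax x hxne]),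
      fun r hr0 hr => ?_⟩
    rcases le_total R r with h | h
    · linarith [hfar r h, min_le_left 1 (frho ρ rρ - frho ρ x)]
    · have : frho ρ r ≤ frho ρ x := hxm ⟨⟨hr0, h⟩, hr⟩
      linarith [min_le_right 1 (frho ρ rρ - frho ρ x)]

theorem tendsto_one_sub_div_rpow (t : ℝ) :
    Tendsto (fun d : ℕ => (1 - t ^ 2 / (d : ℝ)) ^ (((d : ℝ) - 3) / 2)) atTop
      (nhds (Real.exp (-t ^ 2 / 2))) := by
  have h1 : Tendsto (fun d : ℕ => (1 + -t ^ 2 / (d : ℝ)) ^ d) atTop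
      (nhds (Real.exp (-t ^ 2))) := Real.tendsto_one_add_div_pow_exp (-t ^ 2)
  have h2 : Tendsto (fun d : ℕ => 1 / 2 - 3 / 2 / (d : ℝ)) atTop (nhds (1 / 2 - 0)) :=
    tendsto_const_nhds.sub (tendsto_const_div_atTop_nhds_zero_nat _)
  have h3 := h1.rpow h2 (Or.inl (Real.exp_ne_zero _))
  rw [← Real.exp_mul] at h3
  rw [show -t ^ 2 / 2 = -t ^ 2 * (1 / 2 - 0) by ring]
  refine h3.congr' ?_
  have h4 : ∀ᶠ d : ℕ in atTop, t ^ 2 ≤ (d : ℝ) :=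
    tendsto_natCast_atTop_atTop.eventually_ge_atTop _
  filter_upwards [h4, eventually_gt_atTop 0] with d hd hd0
  have hd' : (0 : ℝ) < d := by exact_mod_cast hd0
  have hb : 0 ≤ 1 + -t ^ 2 / (d : ℝ) := by
    have : t ^ 2 / d ≤ 1 := by rwa [div_le_one hd']
    rw [neg_div]
    linarith
  rw [← Real.rpow_natCast, ← Real.rpow_mul hb]
  congr 1
  · ring
  · field_simp

theorem one_sub_sq_div_rpow_le {d : ℕ} (hd : 4 ≤ d) {t : ℝ} (ht : |t| ≤ Real.sqrt d) :
    0 ≤ 1 - t ^ 2 / d ∧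
      (1 - t ^ 2 / (d : ℝ)) ^ (((d : ℝ) - 3) / 2) ≤ Real.exp (-(1 / 8) * t ^ 2) := by
  have hd' : (4 : ℝ) ≤ d := by exact_mod_cast hd
  have hb : 0 ≤ 1 - t ^ 2 / d := by
    have : t ^ 2 ≤ d := by
      rw [← sq_abs, ← Real.sq_sqrt (show (0 : ℝ) ≤ d by linarith)]
      gcongr
    have : t ^ 2 / d ≤ 1 := (div_le_one (by linarith)).2 this
    linarith
  refine ⟨hb, ?_⟩
  have h1 : 1 - t ^ 2 / d ≤ Real.exp (-(t ^ 2 / d)) := by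
    have := Real.add_one_le_exp (-(t ^ 2 / (d : ℝ)))
    linarith
  refine (Real.rpow_le_rpow hb h1 (by linarith)).trans ?_
  rw [← Real.exp_mul]
  refine Real.exp_le_exp.2 ?_
  have h2 : 1 / 4 ≤ ((d : ℝ) - 3) / d := by
    rw [div_le_div_iff₀ (by norm_num) (by linarith)]
    linarith
  have h3 : -(t ^ 2 / (d : ℝ)) * (((d : ℝ) - 3) / 2) = -(t ^ 2 / 2 * (((d : ℝ) - 3) / d)) := by
    ring
  rw [h3]
  nlinarith [sq_nonneg t]

/-- `capMass d` converges to `stdPhi` uniformly on `[-√d, √d]`. -/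
theorem exists_capMass_sub_stdPhi_le :
    ∃ η : ℕ → ℝ, Tendsto η atTop (nhds 0) ∧
      ∀ d : ℕ, 4 ≤ d → ∀ r : ℝ, |r| ≤ Real.sqrt d → |capMass d r - stdPhi r| ≤ η d := by
  set ψ : ℕ → ℝ → ℝ := fun d => (Set.Ioc (-Real.sqrt d) (Real.sqrt d)).indicator
    (fun t => (1 - t ^ 2 / (d : ℝ)) ^ (((d : ℝ) - 3) / 2)) with hψ
  set G : ℝ → ℝ := fun s => Real.exp (-s ^ 2 / 2) with hG
  have hGi : MeasureTheory.Integrable G := integrable_exp_neg_sq_div_two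
  have hEi : MeasureTheory.Integrable (fun t : ℝ => Real.exp (-(1 / 8) * t ^ 2)) :=
    integrable_exp_neg_mul_sq (by norm_num)
  have hmeas : ∀ d, MeasureTheory.AEStronglyMeasurable (ψ d) MeasureTheory.volume := by
    intro d
    refine Measurable.aestronglyMeasurable ?_
    refine Measurable.indicator ?_ measurableSet_Ioc
    fun_prop
  have hbd : ∀ d, 4 ≤ d → ∀ t, ‖ψ d t‖ ≤ Real.exp (-(1 / 8) * t ^ 2) := by
    intro d hd t
    by_cases ht : t ∈ Set.Ioc (-Real.sqrt d) (Real.sqrt d)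
    · have h := one_sub_sq_div_rpow_le hd (abs_le.2 ⟨ht.1.le, ht.2⟩)
      rw [hψ]
      simp only [Set.indicator_of_mem ht]
      rw [Real.norm_of_nonneg (Real.rpow_nonneg h.1 _)]
      exact h.2
    · rw [hψ]
      simp only [Set.indicator_of_notMem ht, norm_zero]
      positivity
  have hψi : ∀ d, 4 ≤ d → MeasureTheory.Integrable (ψ d) := fun d hd =>
    hEi.mono' (hmeas d) (Eventually.of_forall (hbd d hd))
  have hlim : ∀ t, Tendsto (fun d => ψ d t) atTop (nhds (G t)) := by
    intro t
    refine (tendsto_one_sub_div_rpow t).congr' ?_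
    have : Tendsto (fun d : ℕ => Real.sqrt d) atTop atTop :=
      Real.tendsto_sqrt_atTop.comp tendsto_natCast_atTop_atTop
    filter_upwards [this.eventually_gt_atTop |t|] with d hd
    have ht : t ∈ Set.Ioc (-Real.sqrt d) (Real.sqrt d) :=
      ⟨(abs_lt.1 hd).1, (abs_lt.1 hd).2.le⟩
    rw [hψ]
    simp only [Set.indicator_of_mem ht]
  refine ⟨fun d => (Real.sqrt (2 * Real.pi))⁻¹ * ∫ t, |ψ d t - G t|, ?_, ?_⟩
  · have : Tendsto (fun d => ∫ t, |ψ d t - G t|) atTop (nhds (∫ _ : ℝ, (0 : ℝ))) := by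
      refine MeasureTheory.tendsto_integral_filter_of_dominated_convergence
        (fun t => Real.exp (-(1 / 8) * t ^ 2) + G t) ?_ ?_ (hEi.add hGi) ?_
      · exact Eventually.of_forall fun d => ((hmeas d).sub hGi.1).norm
      · filter_upwards [eventually_ge_atTop 4] with d hd
        refine Eventually.of_forall fun t => ?_
        have h1 := norm_sub_le (ψ d t) (G t)
        have h2 : ‖G t‖ = G t := Real.norm_of_nonneg (Real.exp_pos _).le
        have h3 := hbd d hd t
        simp only [Real.norm_eq_abs, abs_abs] at *
        linarith
      · refine Eventually.of_forall fun t => ?_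
        have := ((hlim t).sub_const (G t)).abs
        simpa using this
    simpa using this.const_mul (Real.sqrt (2 * Real.pi))⁻¹
  · intro d hd r hr
    have h1 : capMass d r = (Real.sqrt (2 * Real.pi))⁻¹ * ∫ t in Set.Iic r, ψ d t := by
      unfold capMass
      congr 1
      rw [intervalIntegral.integral_of_le (abs_le.1 hr).1, hψ,
        MeasureTheory.setIntegral_indicator measurableSet_Ioc]
      congr 2
      ext x
      simp only [Set.mem_Ioc, Set.mem_inter_iff, Set.mem_Iic]
      exact ⟨fun h => ⟨h.2, h.1, h.2.trans (abs_le.1 hr).2⟩, fun h => ⟨h.2.1, h.1⟩⟩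
    have h2 : stdPhi r = (Real.sqrt (2 * Real.pi))⁻¹ * ∫ t in Set.Iic r, G t := rfl
    rw [h1, h2, ← mul_sub, abs_mul, abs_of_pos (by positivity),
      ← MeasureTheory.integral_sub (hψi d hd).integrableOn hGi.integrableOn]
    refine mul_le_mul_of_nonneg_left ?_ (by positivity)
    refine (MeasureTheory.abs_integral_le_integral_abs).trans ?_
    exact MeasureTheory.setIntegral_le_integral ((hψi d hd).sub hGi).abs
      (Eventually.of_forall fun t => abs_nonneg _)

theorem intervalIntegrable_one_sub_sq_div_rpow {d : ℕ} (hd : 4 ≤ d) (a b : ℝ) :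
    IntervalIntegrable (fun t : ℝ => (1 - t ^ 2 / (d : ℝ)) ^ (((d : ℝ) - 3) / 2))
      MeasureTheory.volume a b := by
  have hd' : (4 : ℝ) ≤ d := by exact_mod_cast hd
  refine Continuous.intervalIntegrable ?_ a b
  exact Continuous.rpow_const (by fun_prop) fun x => Or.inr (by linarith)

theorem capMass_mono {d : ℕ} (hd : 4 ≤ d) {a b : ℝ} (ha : -Real.sqrt d ≤ a) (hab : a ≤ b)
    (hb : b ≤ Real.sqrt d) : capMass d a ≤ capMass d b := by
  unfold capMass
  refine mul_le_mul_of_nonneg_left ?_ (by positivity)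
  rw [← intervalIntegral.integral_add_adjacent_intervals
    (intervalIntegrable_one_sub_sq_div_rpow hd (-Real.sqrt d) a)
    (intervalIntegrable_one_sub_sq_div_rpow hd a b)]
  have : 0 ≤ ∫ t in a..b, (1 - t ^ 2 / (d : ℝ)) ^ (((d : ℝ) - 3) / 2) := by
    refine intervalIntegral.integral_nonneg hab fun t ht => ?_
    exact Real.rpow_nonneg (one_sub_sq_div_rpow_le hd
      (abs_le.2 ⟨ha.trans ht.1, ht.2.trans hb⟩)).1 _
  linarith

theorem capMass_nonneg {d : ℕ} (hd : 4 ≤ d) {r : ℝ} (hr : |r| ≤ Real.sqrt d) :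
    0 ≤ capMass d r := by
  have h := capMass_mono hd le_rfl (abs_le.1 hr).1 (abs_le.1 hr).2
  have h0 : capMass d (-Real.sqrt d) = 0 := by simp [capMass]
  linarith

theorem tendsto_capMass (r : ℝ) :
    Tendsto (fun d => capMass d r) atTop (nhds (stdPhi r)) := by
  obtain ⟨η, hη, h⟩ := exists_capMass_sub_stdPhi_le
  rw [tendsto_iff_norm_sub_tendsto_zero]
  refine squeeze_zero' (Eventually.of_forall fun d => norm_nonneg _) ?_ hη
  have : Tendsto (fun d : ℕ => Real.sqrt d) atTop atTop :=
    Real.tendsto_sqrt_atTop.comp tendsto_natCast_atTop_atTop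
  filter_upwards [this.eventually_ge_atTop |r|, eventually_ge_atTop 4] with d hd hd4
  exact h d hd4 r hd

/-- The positive constant relating the two normalisations of the cap mass. -/
noncomputable def capConst (d : ℕ) : ℝ := c1 d / Real.sqrt d * Real.sqrt (2 * Real.pi)

theorem capConst_pos {d : ℕ} (hd : 2 ≤ d) : 0 < capConst d := by
  have hd' : (2 : ℝ) ≤ d := by exact_mod_cast hd
  have h1 : 0 < Real.Gamma ((d : ℝ) / 2) := Real.Gamma_pos_of_pos (by linarith)
  have h2 : 0 < Real.Gamma (((d : ℝ) - 1) / 2) := Real.Gamma_pos_of_pos (by linarith)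
  have h3 : 0 < Real.sqrt d := Real.sqrt_pos.2 (by linarith)
  unfold capConst c1
  have := Real.pi_pos
  positivity

theorem c1_mul_integral_eq {d : ℕ} (hd : 2 ≤ d) (h : ℝ) :
    (c1 d * ∫ s in (-1 : ℝ)..h, (1 - s ^ 2) ^ (((d : ℝ) - 3) / 2)) =
      capConst d * capMass d (Real.sqrt d * h) := by
  have hd' : (2 : ℝ) ≤ d := by exact_mod_cast hd
  have h3 : 0 < Real.sqrt d := Real.sqrt_pos.2 (by linarith)
  have hsub := intervalIntegral.integral_comp_div (a := -Real.sqrt d) (b := Real.sqrt d * h)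
    (fun s : ℝ => (1 - s ^ 2) ^ (((d : ℝ) - 3) / 2)) h3.ne'
  rw [neg_div, div_self h3.ne', mul_div_cancel_left₀ _ h3.ne'] at hsub
  simp only [div_pow, Real.sq_sqrt (show (0 : ℝ) ≤ d by linarith), smul_eq_mul] at hsub
  unfold capMass capConst
  rw [hsub]
  have := Real.pi_pos
  have h4 : Real.sqrt (2 * Real.pi) ≠ 0 := by positivity
  field_simp

/-- The integrand of `II`, up to the factor `capConst d ^ N`, in the scale `r = √d * h`. -/
noncomputable def heightDensity (d N : ℕ) (r : ℝ) : ℝ :=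
  (1 - r ^ 2 / d) ^ (((d : ℝ) ^ 2 - 2 * (d : ℝ) - 1) / 2) * capMass d r ^ N

theorem II_eq {n d : ℕ} (hd : 2 ≤ d) (a b : ℝ) :
    II n d a b =
      capConst d ^ (n - d) * ∫ h in a..b, heightDensity d (n - d) (Real.sqrt d * h) := by
  have hd' : (2 : ℝ) ≤ d := by exact_mod_cast hd
  unfold II heightDensity
  rw [← intervalIntegral.integral_const_mul]
  congr 1
  ext h
  rw [c1_mul_integral_eq hd, mul_pow, mul_pow, Real.sq_sqrt (by linarith),
    mul_div_cancel_left₀ _ (by linarith)]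
  ring

theorem continuous_heightDensity {d : ℕ} (hd : 4 ≤ d) (N : ℕ) :
    Continuous (heightDensity d N) := by
  have hd' : (4 : ℝ) ≤ d := by exact_mod_cast hd
  unfold heightDensity capMass
  refine Continuous.mul ?_ ((continuous_const.mul ?_).pow N)
  · exact Continuous.rpow_const (by fun_prop) fun x => Or.inr (by nlinarith)
  · exact intervalIntegral.continuous_primitive
      (intervalIntegrable_one_sub_sq_div_rpow hd) _

theorem heightDensity_nonneg {d : ℕ} (hd : 4 ≤ d) (N : ℕ) {r : ℝ} (hr : |r| ≤ Real.sqrt d) :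
    0 ≤ heightDensity d N r :=
  mul_nonneg (Real.rpow_nonneg (one_sub_sq_div_rpow_le hd hr).1 _)
    (pow_nonneg (capMass_nonneg hd hr) N)

section Laplace

variable {d N : ℕ → ℕ} {ρ rρ ε δ : ℝ}

theorem tendsto_two_mul_exponent_div_sq (hdi : Tendsto d atTop atTop) :
    Tendsto (fun n => ((d n : ℝ) ^ 2 - 2 * (d n : ℝ) - 1) / (d n : ℝ) ^ 2) atTop (nhds 1) := by
  have h0 : Tendsto (fun n => ((d n : ℝ))⁻¹) atTop (nhds 0) :=
    tendsto_inv_atTop_zero.comp (tendsto_natCast_atTop_atTop.comp hdi)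
  have h1 : Tendsto (fun n => 1 - 2 * (d n : ℝ)⁻¹ - ((d n : ℝ)⁻¹) ^ 2) atTop
      (nhds (1 - 2 * 0 - 0 ^ 2)) :=
    (tendsto_const_nhds.sub (h0.const_mul 2)).sub (h0.pow 2)
  norm_num at h1
  refine h1.congr' ?_
  filter_upwards [hdi.eventually_gt_atTop 0] with n hn
  have : (d n : ℝ) ≠ 0 := by exact_mod_cast hn.ne'
  field_simp

theorem eventually_heightDensity_le (hdi : Tendsto d atTop atTop)
    (hN : Tendsto (fun n => (N n : ℝ) / d n) atTop (nhds ρ)) (hδ : 0 < δ) (hε : ε < rρ)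
    (hrρ : 0 < rρ)
    (hgap : ∀ r : ℝ, 0 ≤ r → ε ≤ |r - rρ| → frho ρ r ≤ frho ρ rρ - 3 * δ) :
    ∀ᶠ n in atTop, ∀ r : ℝ, |r| ≤ Real.sqrt (d n) → ε ≤ |r - rρ| →
      heightDensity (d n) (N n) r ≤ Real.exp (d n * (frho ρ rρ - 2 * δ)) := by
  obtain ⟨η, hη, hcap⟩ := exists_capMass_sub_stdPhi_le
  have hκ := tendsto_two_mul_exponent_div_sq hdi
  set κ : ℕ → ℝ := fun n => ((d n : ℝ) ^ 2 - 2 * (d n : ℝ) - 1) / (d n : ℝ) ^ 2 with hκdef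
  have hη' := hη.comp hdi
  have hbound : Tendsto (fun n => κ n * (frho ρ rρ - 3 * δ) +
      |(N n : ℝ) / d n - κ n * ρ| * |Real.log (stdPhi 0)| +
        (N n : ℝ) / d n * (η (d n) / stdPhi 0)) atTop
      (nhds (1 * (frho ρ rρ - 3 * δ) + |ρ - 1 * ρ| * |Real.log (stdPhi 0)| +
        ρ * (0 / stdPhi 0))) :=
    ((hκ.mul_const _).add ((hN.sub (hκ.mul_const ρ)).abs.mul_const _)).add
      (hN.mul (hη'.div_const _))
  have hev := hbound.eventually_lt_const (u := frho ρ rρ - 2 * δ) (by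
    simp only [one_mul, sub_self, abs_zero, zero_mul, zero_div, mul_zero, add_zero]
    linarith)
  filter_upwards [hev, hdi.eventually_ge_atTop 4] with n hn hd4
  have hd' : (4 : ℝ) ≤ d n := by exact_mod_cast hd4
  have hκ0 : 0 ≤ κ n := div_nonneg (by nlinarith) (by positivity)
  have hP0 := stdPhi_pos 0
  have hpos : ∀ r : ℝ, 0 ≤ r → |r| ≤ Real.sqrt (d n) → ε ≤ |r - rρ| →
      heightDensity (d n) (N n) r ≤ Real.exp (d n * (frho ρ rρ - 2 * δ)) := by
    intro r hr0 hr hrε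
    obtain ⟨hb0, -⟩ := one_sub_sq_div_rpow_le hd4 hr
    have hη0 : 0 ≤ η (d n) := (abs_nonneg _).trans (hcap (d n) hd4 r hr)
    have hPr := stdPhi_pos r
    have hP0r : stdPhi 0 ≤ stdPhi r := stdPhi_mono hr0
    have h1 : capMass (d n) r ≤ Real.exp (Real.log (stdPhi r) + η (d n) / stdPhi 0) := by
      have h2 := (abs_le.1 (hcap (d n) hd4 r hr)).2
      rw [Real.exp_add, Real.exp_log hPr]
      have h3 := Real.add_one_le_exp (η (d n) / stdPhi 0)
      have h4 : η (d n) ≤ stdPhi r * (η (d n) / stdPhi 0) := by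
        rw [mul_div_assoc', le_div_iff₀ hP0]
        nlinarith
      nlinarith
    have h2 : (1 - r ^ 2 / (d n : ℝ)) ^ (((d n : ℝ) ^ 2 - 2 * (d n : ℝ) - 1) / 2) ≤
        Real.exp (-(r ^ 2 / (d n : ℝ)) * (((d n : ℝ) ^ 2 - 2 * (d n : ℝ) - 1) / 2)) := by
      rw [Real.exp_mul]
      refine Real.rpow_le_rpow hb0 ?_ (by nlinarith)
      have := Real.add_one_le_exp (-(r ^ 2 / (d n : ℝ)))
      linarith
    have h3 : capMass (d n) r ^ N n ≤
        Real.exp (N n * (Real.log (stdPhi r) + η (d n) / stdPhi 0)) := by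
      rw [Real.exp_nat_mul]
      exact pow_le_pow_left₀ (capMass_nonneg hd4 hr) h1 _
    unfold heightDensity
    refine (mul_le_mul h2 h3 (pow_nonneg (capMass_nonneg hd4 hr) _) (Real.exp_pos _).le).trans ?_
    rw [← Real.exp_add]
    refine Real.exp_le_exp.2 ?_
    have h4 : -(r ^ 2 / (d n : ℝ)) * (((d n : ℝ) ^ 2 - 2 * (d n : ℝ) - 1) / 2) +
        N n * (Real.log (stdPhi r) + η (d n) / stdPhi 0) =
        d n * (κ n * frho ρ r + ((N n : ℝ) / d n - κ n * ρ) * Real.log (stdPhi r) +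
          (N n : ℝ) / d n * (η (d n) / stdPhi 0)) := by
      simp only [hκdef, frho]
      field_simp
      ring
    rw [h4]
    refine mul_le_mul_of_nonneg_left ?_ (by linarith)
    have h5 : ((N n : ℝ) / d n - κ n * ρ) * Real.log (stdPhi r) ≤
        |(N n : ℝ) / d n - κ n * ρ| * |Real.log (stdPhi 0)| := by
      refine (le_abs_self _).trans ?_
      rw [abs_mul]
      refine mul_le_mul_of_nonneg_left ?_ (abs_nonneg _)
      have h6 := Real.log_nonpos hPr.le (stdPhi_le_one r)
      have h7 := Real.log_le_log hP0 hP0r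
      rw [abs_of_nonpos h6, abs_of_nonpos (h7.trans h6)]
      linarith
    have h8 := mul_le_mul_of_nonneg_left (hgap r hr0 hrε) hκ0
    linarith
  intro r hr hrε
  rcases le_total 0 r with h | h
  · exact hpos r h hr hrε
  · have h0 : |(0 : ℝ)| ≤ Real.sqrt (d n) := by simp
    refine le_trans ?_ (hpos 0 le_rfl h0 (by
      rw [zero_sub, abs_neg, abs_of_pos hrρ]
      exact hε.le))
    obtain ⟨hb0, -⟩ := one_sub_sq_div_rpow_le hd4 hr
    unfold heightDensity
    have h1 : (0 : ℝ) ≤ r ^ 2 / d n := by positivity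
    refine mul_le_mul ?_ ?_ (pow_nonneg (capMass_nonneg hd4 hr) _) (by simp)
    · refine Real.rpow_le_rpow hb0 ?_ (by nlinarith)
      simpa using h1
    · exact pow_le_pow_left₀ (capMass_nonneg hd4 hr)
        (capMass_mono hd4 (abs_le.1 hr).1 h (by simp)) _

theorem exists_eventually_le_heightDensity (hdi : Tendsto d atTop atTop)
    (hN : Tendsto (fun n => (N n : ℝ) / d n) atTop (nhds ρ)) (hδ : 0 < δ) (hrρ : 0 < rρ) :
    ∃ η : ℝ, 0 < η ∧ ∀ᶠ n in atTop, rρ + η ≤ Real.sqrt (d n) ∧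
      ∀ r ∈ Set.Icc rρ (rρ + η),
        Real.exp (d n * (frho ρ rρ - δ)) ≤ heightDensity (d n) (N n) r := by
  obtain ⟨η, hη, hηδ⟩ : ∃ η : ℝ, 0 < η ∧ (rρ + η) ^ 2 / 2 < rρ ^ 2 / 2 + δ := by
    have hc : Tendsto (fun η : ℝ => (rρ + η) ^ 2 / 2) (nhdsWithin 0 (Set.Ioi 0))
        (nhds ((rρ + 0) ^ 2 / 2)) :=
      (Continuous.tendsto (by fun_prop) 0).mono_left nhdsWithin_le_nhds
    obtain ⟨η, h1, h2⟩ := ((hc.eventually_lt_const (u := rρ ^ 2 / 2 + δ)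
      (by simpa using hδ)).and self_mem_nhdsWithin).exists
    exact ⟨η, h2, h1⟩
  refine ⟨η, hη, ?_⟩
  have hκ := tendsto_two_mul_exponent_div_sq hdi
  set κ : ℕ → ℝ := fun n => ((d n : ℝ) ^ 2 - 2 * (d n : ℝ) - 1) / (d n : ℝ) ^ 2 with hκdef
  have hdR : Tendsto (fun n => (d n : ℝ)) atTop atTop := tendsto_natCast_atTop_atTop.comp hdi
  have hy : Tendsto (fun n => 1 - (rρ + η) ^ 2 / (d n : ℝ)) atTop (nhds (1 - 0)) :=
    tendsto_const_nhds.sub (hdR.const_div_atTop _)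
  have hC := (tendsto_capMass rρ).comp hdi
  have hlim : Tendsto (fun n => -(κ n * ((rρ + η) ^ 2 / 2) / (1 - (rρ + η) ^ 2 / (d n : ℝ))) +
      (N n : ℝ) / d n * Real.log (capMass (d n) rρ)) atTop
      (nhds (-(1 * ((rρ + η) ^ 2 / 2) / (1 - 0)) + ρ * Real.log (stdPhi rρ))) :=
    ((hκ.mul_const _).div hy (by norm_num)).neg.add
      (hN.mul (hC.log (stdPhi_pos rρ).ne'))
  have hev := hlim.eventually_const_lt (u := frho ρ rρ - δ) (by
    unfold frho
    norm_num
    linarith)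
  have hsq : Tendsto (fun n => Real.sqrt (d n)) atTop atTop := Real.tendsto_sqrt_atTop.comp hdR
  filter_upwards [hev, hdi.eventually_ge_atTop 4, hsq.eventually_ge_atTop (rρ + η),
    hy.eventually_const_lt (u := 0) (by norm_num),
    hC.eventually_const_lt (stdPhi_pos rρ)] with n hn hd4 hs hy0 hC0
  refine ⟨hs, fun r hr => ?_⟩
  have hd' : (4 : ℝ) ≤ d n := by exact_mod_cast hd4
  simp only [Function.comp_apply] at hC0
  set y : ℝ := 1 - (rρ + η) ^ 2 / (d n : ℝ) with hydef
  have hr0 : 0 ≤ r := hrρ.le.trans hr.1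
  have h1 : y ≤ 1 - r ^ 2 / (d n : ℝ) := by
    have : r ^ 2 / (d n : ℝ) ≤ (rρ + η) ^ 2 / (d n : ℝ) := by
      gcongr
      exact hr.2
    linarith
  have h2 : y ^ (((d n : ℝ) ^ 2 - 2 * (d n : ℝ) - 1) / 2) ≤
      (1 - r ^ 2 / (d n : ℝ)) ^ (((d n : ℝ) ^ 2 - 2 * (d n : ℝ) - 1) / 2) :=
    Real.rpow_le_rpow hy0.le h1 (by nlinarith)
  have h3 : capMass (d n) rρ ^ N n ≤ capMass (d n) r ^ N n :=
    pow_le_pow_left₀ hC0.le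
      (capMass_mono hd4 (by linarith [Real.sqrt_nonneg (d n)]) hr.1 (hr.2.trans hs)) _
  unfold heightDensity
  refine le_trans ?_ (mul_le_mul h2 h3 (pow_nonneg hC0.le _)
    ((Real.rpow_nonneg hy0.le _).trans h2))
  rw [Real.rpow_def_of_pos hy0, ← Real.exp_log (pow_pos hC0 (N n)), Real.log_pow,
    ← Real.exp_add]
  refine Real.exp_le_exp.2 ?_
  have h4 := Real.one_sub_inv_le_log_of_pos hy0
  have h5 : 1 - y⁻¹ = -((rρ + η) ^ 2 / d n) / y := by
    rw [eq_div_iff hy0.ne', sub_mul, inv_mul_cancel₀ hy0.ne', hydef]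
    ring
  have h6 : (0 : ℝ) ≤ ((d n : ℝ) ^ 2 - 2 * (d n : ℝ) - 1) / 2 := by nlinarith
  have h7 := mul_le_mul_of_nonneg_right h4 h6
  rw [h5] at h7
  have h8 : d n * (-(κ n * ((rρ + η) ^ 2 / 2) / y) +
      (N n : ℝ) / d n * Real.log (capMass (d n) rρ)) =
      -((rρ + η) ^ 2 / d n) / y * (((d n : ℝ) ^ 2 - 2 * (d n : ℝ) - 1) / 2) +
        N n * Real.log (capMass (d n) rρ) := by
    simp only [hκdef]
    have := hy0.ne'
    field_simp
  have h9 := mul_le_mul_of_nonneg_left hn.le (show (0 : ℝ) ≤ d n by linarith)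
  linarith

theorem integral_heightDensity_le {m k : ℕ} (hm : 4 ≤ m) {a b B : ℝ} (ha : -1 ≤ a)
    (hab : a ≤ b) (hb : b ≤ 1) (hB : 0 ≤ B)
    (h : ∀ x ∈ Set.Icc a b, heightDensity m k (Real.sqrt m * x) ≤ B) :
    ∫ x in a..b, heightDensity m k (Real.sqrt m * x) ≤ 2 * B := by
  have hcont : Continuous fun x => heightDensity m k (Real.sqrt m * x) :=
    (continuous_heightDensity hm k).comp (by fun_prop)
  refine (intervalIntegral.integral_mono_on hab (hcont.intervalIntegrable _ _)
    intervalIntegrable_const h).trans ?_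
  rw [intervalIntegral.integral_const, smul_eq_mul]
  nlinarith

theorem heightDensity_sqrt_mul_nonneg {m : ℕ} (hm : 4 ≤ m) (k : ℕ) {x : ℝ} (hx : |x| ≤ 1) :
    0 ≤ heightDensity m k (Real.sqrt m * x) := by
  refine heightDensity_nonneg hm k ?_
  rw [abs_mul, abs_of_nonneg (Real.sqrt_nonneg _)]
  exact mul_le_of_le_one_right (Real.sqrt_nonneg _) hx

theorem le_integral_heightDensity {m k : ℕ} (hm : 4 ≤ m) {r η B : ℝ} (hr : 0 < r) (hη : 0 < η)
    (hs : r + η ≤ Real.sqrt m)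
    (h : ∀ x ∈ Set.Icc r (r + η), B ≤ heightDensity m k x) :
    η / Real.sqrt m * B ≤ ∫ x in (-1 : ℝ)..1, heightDensity m k (Real.sqrt m * x) := by
  have hcont : Continuous fun x => heightDensity m k (Real.sqrt m * x) :=
    (continuous_heightDensity hm k).comp (by fun_prop)
  have hs0 : 0 < Real.sqrt m := by linarith
  have h1 : r / Real.sqrt m ≤ (r + η) / Real.sqrt m := by gcongr; linarith
  have h2 : (r + η) / Real.sqrt m ≤ 1 := (div_le_one hs0).2 hs
  have h3 : 0 ≤ r / Real.sqrt m := by positivity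
  have h4 : ∫ x in (r / Real.sqrt m)..((r + η) / Real.sqrt m), heightDensity m k (Real.sqrt m * x) ≤
      ∫ x in (-1 : ℝ)..1, heightDensity m k (Real.sqrt m * x) := by
    refine intervalIntegral.integral_mono_interval (by linarith) h1 h2 ?_
      (hcont.intervalIntegrable _ _)
    refine (MeasureTheory.ae_restrict_iff' measurableSet_Ioc).2 (Eventually.of_forall fun x hx => ?_)
    exact heightDensity_sqrt_mul_nonneg hm k (abs_le.2 ⟨hx.1.le, hx.2⟩)
  refine le_trans ?_ h4
  have h5 := intervalIntegral.integral_mono_on h1 intervalIntegrable_const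
    (hcont.intervalIntegrable _ _) (f := fun _ => B) (μ := MeasureTheory.volume) (fun x hx => by
      refine h _ ⟨?_, ?_⟩
      · rw [mul_comm]
        exact (div_le_iff₀ hs0).1 hx.1
      · rw [mul_comm]
        exact (le_div_iff₀ hs0).1 hx.2)
  rw [intervalIntegral.integral_const, smul_eq_mul] at h5
  refine le_trans (le_of_eq ?_) h5
  ring

/-- Heights outside an `ε`-neighbourhood of `rρ` in the scale `√d` are negligible. -/
theorem tendsto_II_div_II (hρ : 0 < ρ) (hdi : Tendsto d atTop atTop)
    (hN : Tendsto (fun n => ((n - d n : ℕ) : ℝ) / d n) atTop (nhds ρ)) (hrρ : 0 < rρ)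
    (hmax : ∀ r : ℝ, r ≠ rρ → frho ρ r < frho ρ rρ) (hε0 : 0 < ε) (hε : ε < rρ)
    {a b : ℕ → ℝ}
    (hab : ∀ᶠ n in atTop, -1 ≤ a n ∧ a n ≤ b n ∧ b n ≤ 1 ∧
      ∀ x ∈ Set.Icc (a n) (b n), ε ≤ |Real.sqrt (d n) * x - rρ|) :
    Tendsto (fun n => II n (d n) (a n) (b n) / II n (d n) (-1) 1) atTop (nhds 0) ∧
      ∀ᶠ n in atTop, 0 < II n (d n) (-1) 1 := by
  obtain ⟨δ', hδ', hgap⟩ := exists_gap_frho hρ hε0 hmax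
  obtain ⟨δ, hδ, rfl⟩ : ∃ δ : ℝ, 0 < δ ∧ δ' = 3 * δ := ⟨δ' / 3, by linarith, by ring⟩
  have hup := eventually_heightDensity_le hdi hN hδ hε hrρ hgap
  obtain ⟨η, hη, hlow⟩ := exists_eventually_le_heightDensity hdi hN hδ hrρ
  have hpos : ∀ᶠ n in atTop, 0 < η / Real.sqrt (d n) * Real.exp (d n * (frho ρ rρ - δ)) ∧
      η / Real.sqrt (d n) * Real.exp (d n * (frho ρ rρ - δ)) ≤
        ∫ x in (-1 : ℝ)..1, heightDensity (d n) (n - d n) (Real.sqrt (d n) * x) := by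
    filter_upwards [hlow, hdi.eventually_ge_atTop 4] with n hn hd4
    have : 0 < Real.sqrt (d n) := by linarith [hn.1]
    exact ⟨by positivity, le_integral_heightDensity hd4 hrρ hη hn.1 hn.2⟩
  refine ⟨?_, ?_⟩
  · have hsq : Tendsto (fun n => Real.sqrt (d n) * Real.sqrt (d n) *
        Real.exp (-(δ * d n))) atTop (nhds 0) := by
      have h1 := (Real.tendsto_pow_mul_exp_neg_atTop_nhds_zero 1).comp
        ((tendsto_natCast_atTop_atTop.comp hdi).const_mul_atTop hδ)
      have h2 := h1.const_mul δ⁻¹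
      rw [mul_zero] at h2
      refine h2.congr fun n => ?_
      simp only [Function.comp_apply, pow_one]
      rw [Real.mul_self_sqrt (Nat.cast_nonneg _)]
      field_simp
    have hlim := hsq.const_mul (2 / η)
    rw [mul_zero] at hlim
    have hall : ∀ᶠ n in atTop, 0 ≤ II n (d n) (a n) (b n) / II n (d n) (-1) 1 ∧
        II n (d n) (a n) (b n) / II n (d n) (-1) 1 ≤
          2 / η * (Real.sqrt (d n) * Real.sqrt (d n) * Real.exp (-(δ * d n))) := by
      filter_upwards [hup, hab, hpos, hdi.eventually_ge_atTop 4] with n hn habn hpn hd4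
      obtain ⟨ha, hab', hb, hsep⟩ := habn
      have hd' : (4 : ℝ) ≤ d n := by exact_mod_cast hd4
      have hd2 : 2 ≤ d n := by omega
      have hs1 : 1 ≤ Real.sqrt (d n) := Real.one_le_sqrt.2 (by linarith)
      have hK : capConst (d n) ^ (n - d n) ≠ 0 := (pow_pos (capConst_pos hd2) _).ne'
      rw [II_eq hd2, II_eq hd2, mul_div_mul_left _ _ hK]
      have hnum0 : 0 ≤ ∫ x in (a n)..(b n),
          heightDensity (d n) (n - d n) (Real.sqrt (d n) * x) :=
        intervalIntegral.integral_nonneg hab' fun x hx =>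
          heightDensity_sqrt_mul_nonneg hd4 _ (abs_le.2 ⟨ha.trans hx.1, hx.2.trans hb⟩)
      have hnum := integral_heightDensity_le (k := n - d n) hd4 ha hab' hb
        (Real.exp_pos (d n * (frho ρ rρ - 2 * δ))).le (fun x hx => by
          refine hn _ ?_ (hsep x hx)
          rw [abs_mul, abs_of_nonneg (Real.sqrt_nonneg _)]
          exact mul_le_of_le_one_right (Real.sqrt_nonneg _)
            (abs_le.2 ⟨ha.trans hx.1, hx.2.trans hb⟩))
      refine ⟨div_nonneg hnum0 (hpn.1.le.trans hpn.2), ?_⟩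
      refine (div_le_div₀ (by positivity) hnum hpn.1 hpn.2).trans ?_
      rw [div_le_iff₀ hpn.1]
      have hexp : Real.exp (d n * (frho ρ rρ - 2 * δ)) =
          Real.exp (-(δ * d n)) * Real.exp (d n * (frho ρ rρ - δ)) := by
        rw [← Real.exp_add]
        congr 1
        ring
      have heq : 2 / η * (Real.sqrt (d n) * Real.sqrt (d n) * Real.exp (-(δ * d n))) *
          (η / Real.sqrt (d n) * Real.exp (d n * (frho ρ rρ - δ))) =
          Real.sqrt (d n) * (2 * Real.exp (d n * (frho ρ rρ - 2 * δ))) := by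
        rw [hexp]
        field_simp
      rw [heq]
      exact le_mul_of_one_le_left (by positivity) hs1
    exact squeeze_zero' (hall.mono fun n h => h.1) (hall.mono fun n h => h.2) hlim
  · filter_upwards [hpos, hdi.eventually_ge_atTop 4] with n hpn hd4
    have hd2 : 2 ≤ d n := by omega
    rw [II_eq hd2]
    exact mul_pos (pow_pos (capConst_pos hd2) _) (hpn.1.trans_le hpn.2)

end Laplace

theorem II_add_II {n d : ℕ} (hd : 4 ≤ d) (a b c : ℝ) :
    II n d a b + II n d b c = II n d a c := by
  have hcont : Continuous fun x => heightDensity d (n - d) (Real.sqrt d * x) :=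
    (continuous_heightDensity hd _).comp (by fun_prop)
  rw [II_eq (by omega), II_eq (by omega), II_eq (by omega), ← mul_add,
    intervalIntegral.integral_add_adjacent_intervals (hcont.intervalIntegrable _ _)
      (hcont.intervalIntegrable _ _)]

/-- in the linear regime `(n-d)/d → ρ > 0` with `d → ∞`,
`√d · H_typ → r_ρ` in probability, where `r_ρ` is the unique maximizer of `f_ρ`. -/
theorem typical_height_linear (d : ℕ → ℕ) (ρ : ℝ) (hρ : 0 < ρ)
    (hd : ∀ᶠ n in atTop, 2 ≤ d n ∧ d n < n)
    (hdi : Tendsto (fun n : ℕ => (d n : ℝ)) atTop atTop)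
    (hreg : Tendsto (fun n : ℕ => ((n : ℝ) - (d n : ℝ)) / (d n : ℝ)) atTop (nhds ρ))
    (rρ : ℝ) (hrρ : 0 < rρ)
    (hmax : ∀ r : ℝ, r ≠ rρ → frho ρ r < frho ρ rρ) :
    ∀ ε : ℝ, 0 < ε → ε < rρ →
      Tendsto (fun n : ℕ =>
          II n (d n) (-1) ((rρ - ε) / Real.sqrt (d n)) / II n (d n) (-1) 1) atTop (nhds 0) ∧
      Tendsto (fun n : ℕ =>
          II n (d n) (-1) ((rρ + ε) / Real.sqrt (d n)) / II n (d n) (-1) 1) atTop (nhds 1) := by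
  intro ε hε0 hε
  have hdn : Tendsto d atTop atTop := tendsto_natCast_atTop_iff.1 hdi
  have hN : Tendsto (fun n => ((n - d n : ℕ) : ℝ) / d n) atTop (nhds ρ) := by
    refine hreg.congr' ?_
    filter_upwards [hd] with n hn
    rw [Nat.cast_sub hn.2.le]
  have hsq : Tendsto (fun n => Real.sqrt (d n)) atTop atTop := Real.tendsto_sqrt_atTop.comp hdi
  have hlow := tendsto_II_div_II hρ hdn hN hrρ hmax hε0 hε
    (a := fun _ => -1) (b := fun n => (rρ - ε) / Real.sqrt (d n)) (by
      filter_upwards [hsq.eventually_ge_atTop (rρ + ε)] with n hn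
      have hs0 : 0 < Real.sqrt (d n) := by linarith
      have h0 : 0 ≤ (rρ - ε) / Real.sqrt (d n) := div_nonneg (by linarith) hs0.le
      refine ⟨le_rfl, by linarith, (div_le_one hs0).2 (by linarith), fun x hx => ?_⟩
      have := (le_div_iff₀ hs0).1 hx.2
      rw [le_abs]
      right
      linarith)
  have hhigh := tendsto_II_div_II hρ hdn hN hrρ hmax hε0 hε
    (a := fun n => (rρ + ε) / Real.sqrt (d n)) (b := fun _ => 1) (by
      filter_upwards [hsq.eventually_ge_atTop (rρ + ε)] with n hn
      have hs0 : 0 < Real.sqrt (d n) := by linarith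
      have h0 : 0 ≤ (rρ + ε) / Real.sqrt (d n) := div_nonneg (by linarith) hs0.le
      refine ⟨by linarith, (div_le_one hs0).2 hn, le_rfl, fun x hx => ?_⟩
      have := (div_le_iff₀ hs0).1 hx.1
      rw [le_abs]
      left
      linarith)
  refine ⟨hlow.1, ?_⟩
  have h1 := hhigh.1.const_sub 1
  rw [sub_zero] at h1
  refine h1.congr' ?_
  filter_upwards [hhigh.2, hdn.eventually_ge_atTop 4] with n hpos hd4
  rw [eq_div_iff hpos.ne', sub_mul, div_mul_cancel₀ _ hpos.ne', one_mul, sub_eq_iff_eq_add,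
    II_add_II hd4]
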